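/- There exist real numbers 0 < ε < R, a constant c > 0, and an infinitely differentiable function ρ : ℝ → ℝ such that: ρ(r) = sin r for all r ≤ ε; ρ(r) = 1 for all r ≥ R; ρ(r) > 0 for all r > 0; and for every r > 0 the inequality 6 (1 − ρ′(r)² − ρ(r) ρ″(r)) ≥ c · ρ(r)² holds. -/

import Mathlib

open Real Set

/-- A primitive of `1 - Real.smoothTransition`: the identity on `(-∞, 0]`, constant on `[1, ∞)`. -/
noncomputable def smoothCap (x : ℝ) : ℝ :=
  ∫ t in (0 : ℝ)..x, (1 - smoothTransition t)

namespace smoothCap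

lemma hasDerivAt (x : ℝ) : HasDerivAt smoothCap (1 - smoothTransition x) x :=
  (continuous_const.sub smoothTransition.continuous).integral_hasStrictDerivAt 0 x |>.hasDerivAt

lemma deriv_eq : deriv smoothCap = fun x => 1 - smoothTransition x :=
  funext fun x => (hasDerivAt x).deriv

protected lemma contDiff : ContDiff ℝ (⊤ : ℕ∞) smoothCap := by
  refine contDiff_infty_iff_deriv.2 ⟨fun x => (hasDerivAt x).differentiableAt, ?_⟩
  rw [deriv_eq]
  exact contDiff_const.sub smoothTransition.contDiff

protected lemma monotone : Monotone smoothCap :=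
  monotone_of_hasDerivAt_nonneg hasDerivAt fun x => sub_nonneg.2 (smoothTransition.le_one x)

protected lemma zero : smoothCap 0 = 0 := by simp [smoothCap]

lemma eq_self_of_nonpos {x : ℝ} (hx : x ≤ 0) : smoothCap x = x := by
  have h : smoothCap x = ∫ _ in (0 : ℝ)..x, (1 : ℝ) := by
    refine intervalIntegral.integral_congr fun t ht => ?_
    rw [uIcc_of_ge hx] at ht
    simp [smoothTransition.zero_of_nonpos ht.2]
  simpa using h

lemma eq_of_one_le {x : ℝ} (hx : 1 ≤ x) : smoothCap x = smoothCap 1 := by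
  have hc : Continuous fun t => 1 - smoothTransition t :=
    continuous_const.sub smoothTransition.continuous
  have h : ∫ t in (1 : ℝ)..x, (1 - smoothTransition t) = ∫ _ in (1 : ℝ)..x, (0 : ℝ) := by
    refine intervalIntegral.integral_congr fun t ht => ?_
    rw [uIcc_of_le hx] at ht
    simp [smoothTransition.one_of_one_le ht.1]
  rw [smoothCap, ← intervalIntegral.integral_add_adjacent_intervals
    (hc.intervalIntegrable 0 1) (hc.intervalIntegrable 1 x), h]
  simp [smoothCap]

lemma le_apply_one (x : ℝ) : smoothCap x ≤ smoothCap 1 :=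
  (le_total x 1).elim (fun h => smoothCap.monotone h) fun h => (eq_of_one_le h).le

lemma apply_one_le_one : smoothCap 1 ≤ 1 := by
  have hc : Continuous fun t => 1 - smoothTransition t :=
    continuous_const.sub smoothTransition.continuous
  have h := intervalIntegral.integral_mono (zero_le_one' ℝ) (hc.intervalIntegrable 0 1)
    (continuous_const.intervalIntegrable (μ := MeasureTheory.volume) 0 1)
    (fun t => sub_le_self 1 (smoothTransition.nonneg t))
  simpa [smoothCap] using h

end smoothCap

/-- A nondecreasing concave smooth reparametrization with unit initial speed that stops at
`π / 2`. -/
lemma exists_concave_angle :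
    ∃ (a : ℝ) (φ g : ℝ → ℝ), 0 < a ∧ ContDiff ℝ (⊤ : ℕ∞) φ ∧ Differentiable ℝ g ∧
      (∀ r, HasDerivAt φ (g r) r) ∧ (∀ r, 0 ≤ g r ∧ g r ≤ 1) ∧ (∀ r, deriv g r ≤ 0) ∧
      (∀ r ≤ a, φ r = r) ∧ (∀ r, a + 1 ≤ r → φ r = π / 2) ∧
      (∀ r, 0 < r → 0 < φ r ∧ φ r ≤ π / 2) := by
  have hlt : smoothCap 1 < π / 2 := by linarith [smoothCap.apply_one_le_one, pi_gt_three]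
  obtain ⟨a, ha⟩ : ∃ a, a = π / 2 - smoothCap 1 := ⟨_, rfl⟩
  have ha0 : 0 < a := by linarith
  have hself : ∀ r ≤ a, a + smoothCap (r - a) = r := fun r hr => by
    rw [smoothCap.eq_self_of_nonpos (by linarith)]; ring
  refine ⟨a, fun r => a + smoothCap (r - a), fun r => 1 - smoothTransition (r - a), ha0,
    contDiff_const.add (smoothCap.contDiff.comp (contDiff_id.sub contDiff_const)), ?_, ?_,
    fun r => ⟨sub_nonneg.2 (smoothTransition.le_one _),
      sub_le_self 1 (smoothTransition.nonneg _)⟩, fun r => ?_, hself, fun r hr => ?_,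
    fun r hr => ⟨?_, ?_⟩⟩
  · have : Differentiable ℝ smoothTransition :=
      (smoothTransition.contDiff (n := 1)).differentiable (by simp)
    fun_prop
  · exact fun r => ((smoothCap.hasDerivAt (r - a)).comp_sub_const r a).const_add a
  · refine Antitone.deriv_nonpos fun x y hxy => ?_
    exact sub_le_sub_left (smoothTransition.monotone (sub_le_sub_right hxy a)) 1
  · have := smoothCap.eq_of_one_le (x := r - a) (by linarith)
    dsimp only
    linarith
  · rcases le_total r a with h | h
    · simpa only [hself r h] using hr
    · have := smoothCap.monotone (sub_nonneg.2 h)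
      rw [smoothCap.zero] at this
      dsimp only
      linarith
  · have := smoothCap.le_apply_one (r - a)
    dsimp only
    linarith

/-- **A PSC warping function on `ℝ⁴` with cylindrical end.**
There exist `0 < ε < R`, a constant `c > 0`, and a smooth function `ρ : ℝ → ℝ` with
`ρ r = sin r` for `r ≤ ε`, `ρ r = 1` for `r ≥ R`, `ρ r > 0` for `r > 0`, and such that
`6 (1 - ρ'(r)² - ρ(r) ρ''(r)) ≥ c ρ(r)²` for all `r > 0` (i.e. the warped-product metric
`dr² + ρ(r)² g_{S³}` on `ℝ⁴` has scalar curvature bounded below by `c`). -/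
theorem exists_psc_warping_function :
    ∃ (ε R c : ℝ) (ρ : ℝ → ℝ),
      0 < ε ∧ ε < R ∧ 0 < c ∧ ContDiff ℝ (⊤ : ℕ∞) ρ ∧
      (∀ r : ℝ, r ≤ ε → ρ r = Real.sin r) ∧
      (∀ r : ℝ, R ≤ r → ρ r = 1) ∧
      (∀ r : ℝ, 0 < r → 0 < ρ r) ∧
      (∀ r : ℝ, 0 < r →
        c * (ρ r) ^ 2 ≤ 6 * (1 - (deriv ρ r) ^ 2 - ρ r * deriv (deriv ρ) r)) := by
  obtain ⟨a, φ, g, ha, hφ, hg, hd, hg01, hg', hself, hend, hpos⟩ := exists_concave_angle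
  have hρ : deriv (fun r => sin (φ r)) = fun r => cos (φ r) * g r :=
    funext fun r => (hd r).sin.deriv
  have hsin : ∀ r, 0 < r → 0 < sin (φ r) := fun r hr =>
    sin_pos_of_pos_of_lt_pi (hpos r hr).1 (by linarith [(hpos r hr).2, pi_pos])
  refine ⟨a, a + 1, 6, fun r => sin (φ r), ha, by linarith, by norm_num,
    contDiff_sin.comp hφ, fun r hr => by simp only [hself r hr],
    fun r hr => by simp only [hend r hr, sin_pi_div_two], hsin, fun r hr => ?_⟩
  have hρ' : deriv (fun r => cos (φ r) * g r) r =
      -sin (φ r) * g r * g r + cos (φ r) * deriv g r :=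
    ((hd r).cos.mul (hg r).hasDerivAt).deriv
  rw [hρ, hρ']
  have hcos : 0 ≤ cos (φ r) :=
    cos_nonneg_of_neg_pi_div_two_le_of_le (by linarith [(hpos r hr).1, pi_pos]) (hpos r hr).2
  have hconcave : sin (φ r) * cos (φ r) * deriv g r ≤ 0 :=
    mul_nonpos_of_nonneg_of_nonpos (mul_nonneg (hsin r hr).le hcos) (hg' r)
  have hspeed : cos (φ r) ^ 2 * g r ^ 2 ≤ cos (φ r) ^ 2 :=
    mul_le_of_le_one_right (sq_nonneg _) (pow_le_one₀ (hg01 r).1 (hg01 r).2)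
  have hsq : 0 ≤ sin (φ r) ^ 2 * g r ^ 2 := by positivity
  linear_combination 6 * hconcave + 6 * hspeed + 6 * hsq + 6 * sin_sq_add_cos_sq (φ r)
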